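/- The consistency problem for representable pre-relation algebras is unsolvable: the set of conjunctions of equations in the language with binary operations ∩ and ∘, unary operation ⁻¹, and constant Δ, that admit an assignment of binary relations R₁,…,R_n on some set S, not all equal to the identity relation on S, satisfying all the equations (with ∩ interpreted as intersection of relations, ∘ as relational composition, ⁻¹ as converse, and Δ as the identity relation), is not decidable. The same holds when S is additionally required to be finite. -/

import Mathlib

/-- Terms in the language of pre-relation algebras: binary operations `∩`
(intersection) and `∘` (relational composition), unary `⁻¹` (converse), and a
constant `Δ` (identity relation). -/
inductive RelTerm : Type where
  | var : ℕ → RelTerm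
  | delta : RelTerm
  | inter : RelTerm → RelTerm → RelTerm
  | comp : RelTerm → RelTerm → RelTerm
  | inv : RelTerm → RelTerm

/-- The identity (diagonal) relation on `S`. -/
def idRel' (S : Type*) : Set (S × S) := {p | p.1 = p.2}

/-- Evaluation of a term over binary relations on `S` under the assignment `v`. -/
def RelTerm.eval {S : Type*} (v : ℕ → Set (S × S)) : RelTerm → Set (S × S)
  | .var i => v i
  | .delta => idRel' S
  | .inter s t => s.eval v ∩ t.eval v
  | .comp s t => {p | ∃ y, (p.1, y) ∈ s.eval v ∧ (y, p.2) ∈ t.eval v}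
  | .inv s => {p | (p.2, p.1) ∈ s.eval v}

/-- The variables occurring in a term. -/
def RelTerm.vars : RelTerm → Finset ℕ
  | .var i => {i}
  | .delta => ∅
  | .inter s t => s.vars ∪ t.vars
  | .comp s t => s.vars ∪ t.vars
  | .inv s => s.vars

/-- An injective Gödel numbering of terms. -/
def RelTerm.code : RelTerm → ℕ
  | .var i => 5 * i
  | .delta => 1
  | .inter s t => 5 * Nat.pair s.code t.code + 2
  | .comp s t => 5 * Nat.pair s.code t.code + 3
  | .inv s => 5 * s.code + 4

/-- A conjunction of equations between pre-relation-algebra terms. -/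
abbrev RelConj : Type := List (RelTerm × RelTerm)

/-- The variables occurring in a conjunction. -/
def RelConj.vars (Φ : RelConj) : Finset ℕ :=
  Φ.foldr (fun p s => p.1.vars ∪ p.2.vars ∪ s) ∅

/-- A (natural) Gödel numbering of conjunctions of equations. -/
def RelConj.code (Φ : RelConj) : ℕ :=
  Encodable.encode (Φ.map fun p => Nat.pair p.1.code p.2.code)

/-- `Φ` is satisfied by the assignment `v` of binary relations on `S`. -/
def RelConj.Sat {S : Type*} (Φ : RelConj) (v : ℕ → Set (S × S)) : Prop :=
  ∀ p ∈ Φ, p.1.eval v = p.2.eval v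

/-- The assignment is non-trivial: some occurring variable is assigned a
relation different from the identity relation. -/
def RelConj.Nontriv {S : Type*} (Φ : RelConj) (v : ℕ → Set (S × S)) : Prop :=
  ∃ i ∈ Φ.vars, v i ≠ idRel' S

open Turing.ToPartrec (Code)
open Filter

namespace RelTerm

local infixl:70 "⨾" => RelTerm.comp
local infixl:65 "⊓ᵣ" => RelTerm.inter
local postfix:max "ᵒ" => RelTerm.inv

variable {S : Type*} {v : ℕ → Set (S × S)}

theorem mem_eval_var {i : ℕ} {x y : S} : (x, y) ∈ (var i).eval v ↔ (x, y) ∈ v i := Iff.rfl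

/-- The equation expressing that `s` is included in `t`. -/
def incl (s t : RelTerm) : RelTerm × RelTerm := (s ⊓ᵣ t, s)

/-- The inclusion of `s` in `t` holds under the assignment `v`. -/
def Holds (v : ℕ → Set (S × S)) (s t : RelTerm) : Prop :=
  ∀ x y, (x, y) ∈ s.eval v → (x, y) ∈ t.eval v

theorem eval_incl {s t : RelTerm} :
    (incl s t).1.eval v = (incl s t).2.eval v ↔ Holds v s t := by
  simp only [incl, eval, Set.inter_eq_left, Holds]
  exact ⟨fun h x y hxy => h hxy, fun h p hp => h p.1 p.2 hp⟩

/-! The variables `0, …, 4` denote an empty relation, the constant function zero, the successor,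
and the two projections of a pairing. -/

/-- Intended to denote the empty relation. -/
abbrev bot : RelTerm := var 0
/-- Intended to denote the constant function zero. -/
abbrev zero : RelTerm := var 1
/-- Intended to denote the successor function. -/
abbrev succ : RelTerm := var 2
/-- Intended to denote the first projection. -/
abbrev fst : RelTerm := var 3
/-- Intended to denote the second projection. -/
abbrev snd : RelTerm := var 4

/-- The pairs `(a, b)` such that the first projection of `a` is zero. -/
def fstZero : RelTerm := fst ⨾ (delta ⊓ᵣ zero) ⨾ zeroᵒ

/-- The pairs `(a, b)` such that the first projection of `a` is a successor. -/
def fstPos : RelTerm := fst ⨾ succᵒ ⨾ zero ⨾ zeroᵒ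

/-- An injective numbering of codes. -/
def index : Code → ℕ
  | .zero' => 0
  | .succ => 1
  | .tail => 2
  | .cons f g => 4 * Nat.pair (index f) (index g) + 3
  | .comp f g => 4 * Nat.pair (index f) (index g) + 4
  | .case f g => 4 * Nat.pair (index f) (index g) + 5
  | .fix f => 4 * index f + 6

theorem index_injective : Function.Injective index := by
  intro c
  induction c with
  | zero' | succ | tail => intro d h; cases d <;> simp_all [index]
  | cons f g hf hg | comp f g hf hg | case f g hf hg =>
    intro d h
    cases d <;> simp only [index] at h <;> try omega
    rename_i f' g'
    have h := Nat.pair_eq_pair.1 (by omega :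
      Nat.pair (index f) (index g) = Nat.pair (index f') (index g'))
    rw [hf h.1, hg h.2]
  | fix f hf =>
    intro d h
    cases d <;> simp only [index] at h <;> try omega
    rename_i f'
    rw [hf (by omega : index f = index f')]

/-- The variable denoting the partial function computed by `c`. -/
abbrev prog (c : Code) : RelTerm := var (index c + 5)

/-- The axioms on the arithmetical relations. -/
def baseAxioms : RelConj :=
  [incl delta (zero ⨾ (delta ⊓ᵣ zero) ⨾ zeroᵒ),
   incl zero (succ ⨾ zero),
   incl (zero ⨾ zeroᵒ) (fstᵒ ⨾ snd),
   incl (fst ⨾ zero) zero,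
   incl (delta ⊓ᵣ zero) fst,
   incl (delta ⊓ᵣ zero) snd,
   incl bot delta,
   incl (zero ⨾ bot) bot]

/-- The axioms describing the outermost constructor of a code. -/
def stepAxioms : Code → RelConj
  | .zero' => [incl (zero ⨾ fstᵒ ⊓ᵣ sndᵒ) (prog .zero')]
  | .succ => [incl (fst ⨾ succ ⨾ fstᵒ ⊓ᵣ zero ⨾ sndᵒ) (prog .succ)]
  | .tail => [incl snd (prog .tail)]
  | .cons f g => [incl (prog f ⨾ fst ⨾ fstᵒ ⊓ᵣ prog g ⨾ sndᵒ) (prog (.cons f g))]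
  | .comp f g => [incl (prog g ⨾ prog f) (prog (.comp f g))]
  | .case f g =>
    [incl (fstZero ⊓ᵣ snd ⨾ prog f) (prog (.case f g)),
     incl ((fst ⨾ succᵒ ⨾ fstᵒ ⊓ᵣ snd ⨾ sndᵒ) ⨾ prog g) (prog (.case f g))]
  | .fix f =>
    [incl (prog f ⨾ (fstZero ⊓ᵣ snd)) (prog (.fix f)),
     incl (prog f ⨾ (fstPos ⊓ᵣ snd) ⨾ prog (.fix f)) (prog (.fix f))]

/-- The axioms describing a code and all its subcodes. -/
def codeAxioms : Code → RelConj
  | .zero' => stepAxioms .zero'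
  | .succ => stepAxioms .succ
  | .tail => stepAxioms .tail
  | .cons f g => stepAxioms (.cons f g) ++ (codeAxioms f ++ codeAxioms g)
  | .comp f g => stepAxioms (.comp f g) ++ (codeAxioms f ++ codeAxioms g)
  | .case f g => stepAxioms (.case f g) ++ (codeAxioms f ++ codeAxioms g)
  | .fix f => stepAxioms (.fix f) ++ codeAxioms f

/-- On the domain of `bot` every variable below `M` is the identity. -/
def collapseAxioms (M : ℕ) : RelConj := (List.range M).map fun i => (bot ⨾ var i, bot)

/-- The constant function `n`. -/
def numeral : ℕ → RelTerm
  | 0 => zero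
  | n + 1 => numeral n ⨾ succ

/-- The equation stating that `c` does not return zero on the input `n`. -/
def refutation (c : Code) (n : ℕ) : RelTerm × RelTerm :=
  incl ((numeral n ⨾ fstᵒ ⊓ᵣ zero ⨾ sndᵒ) ⨾ prog c ⨾ fst ⊓ᵣ zero) bot

/-- The part of the theory that depends on the code only. -/
def codeTheory (c : Code) : RelConj :=
  baseAxioms ++ (codeAxioms c ++ collapseAxioms (index c + 6))

/-- A conjunction that is inconsistent if `c` returns zero on `n`, and has a finite nontrivial
model if `c` returns one. -/
def theory (c : Code) (n : ℕ) : RelConj := refutation c n :: codeTheory c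

theorem sat_append {Φ Ψ : RelConj} :
    RelConj.Sat (Φ ++ Ψ) v ↔ Φ.Sat v ∧ Ψ.Sat v := List.forall_mem_append

theorem sat_cons {p : RelTerm × RelTerm} {Φ : RelConj} :
    RelConj.Sat (p :: Φ) v ↔ p.1.eval v = p.2.eval v ∧ Φ.Sat v := List.forall_mem_cons

theorem sat_nil : RelConj.Sat [] v := by simp [RelConj.Sat]

/-! ### Occurring variables -/

theorem vars_cons (p : RelTerm × RelTerm) (Φ : RelConj) :
    RelConj.vars (p :: Φ) = p.1.vars ∪ p.2.vars ∪ Φ.vars := rfl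

theorem vars_nil : RelConj.vars [] = ∅ := rfl

theorem vars_append (Φ Ψ : RelConj) : RelConj.vars (Φ ++ Ψ) = Φ.vars ∪ Ψ.vars := by
  induction Φ with
  | nil => simp [vars_nil]
  | cons p Φ ih =>
    rw [List.cons_append, vars_cons, ih, vars_cons]
    simp only [Finset.union_assoc]

theorem lt_of_mem_vars_codeAxioms (c : Code) :
    ∀ i ∈ RelConj.vars (codeAxioms c), i < index c + 6 := by
  induction c with
  | zero' | succ | tail =>
    simp [codeAxioms, stepAxioms, vars_cons, vars_nil, incl, vars, index]
  | cons f g hf hg | comp f g hf hg | case f g hf hg =>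
    intro i hi
    have h₁ := Nat.left_le_pair (index f) (index g)
    have h₂ := Nat.right_le_pair (index f) (index g)
    specialize hf i
    specialize hg i
    simp only [codeAxioms, vars_append, Finset.mem_union] at hi
    rcases hi with hi | hi | hi
    · simp [stepAxioms, vars_cons, vars_nil, incl, vars, index, fstZero] at hi ⊢
      omega
    · simp only [index]
      have := hf hi
      omega
    · simp only [index]
      have := hg hi
      omega
  | fix f hf =>
    intro i hi
    specialize hf i
    simp only [codeAxioms, vars_append, Finset.mem_union] at hi
    rcases hi with hi | hi
    · simp [stepAxioms, vars_cons, vars_nil, incl, vars, index, fstZero, fstPos] at hi ⊢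
      omega
    · simp only [index]
      have := hf hi
      omega

theorem lt_of_mem_vars_numeral (n : ℕ) : ∀ i ∈ (numeral n).vars, i < 5 := by
  induction n with
  | zero => simp [numeral, vars]
  | succ n ih =>
    intro i hi
    simp only [numeral, vars, Finset.mem_union, Finset.mem_singleton] at hi
    rcases hi with hi | hi
    · exact ih i hi
    · omega

theorem lt_of_mem_vars_collapseAxioms (M : ℕ) :
    ∀ i ∈ RelConj.vars (collapseAxioms (M + 1)), i < M + 1 := by
  have key : ∀ l : List ℕ, ∀ i ∈ RelConj.vars (l.map fun i => (bot ⨾ var i, bot)),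
      i = 0 ∨ i ∈ l := by
    intro l
    induction l with
    | nil => simp [vars_nil]
    | cons a l ih =>
      intro i hi
      simp only [List.map_cons, vars_cons, vars, Finset.mem_union, Finset.mem_singleton] at hi
      rw [List.mem_cons]
      rcases hi with (((h | h) | h) | h)
      · exact Or.inl h
      · exact Or.inr (Or.inl h)
      · exact Or.inl h
      · exact (ih i h).imp id Or.inr
  intro i hi
  rcases key _ i hi with h | h
  · omega
  · exact List.mem_range.1 h

theorem lt_of_mem_vars_theory (c : Code) (n : ℕ) :
    ∀ i ∈ RelConj.vars (theory c n), i < index c + 6 := by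
  intro i hi
  simp only [theory, codeTheory, vars_cons, vars_append, Finset.mem_union] at hi
  rcases hi with hi | hi | hi | hi
  · have := lt_of_mem_vars_numeral n i
    by_cases hmem : i ∈ (numeral n).vars
    · have := this hmem
      omega
    · simp [refutation, incl, vars, hmem] at hi
      omega
  · simp [baseAxioms, vars_cons, vars_nil, incl, vars] at hi
    omega
  · exact lt_of_mem_vars_codeAxioms c i hi
  · exact lt_of_mem_vars_collapseAxioms _ i hi

/-! ### Computations hold in every model -/

/-- The elements `c k` behave like the natural numbers, within the component of those elements
whose zero is `c 0`. -/
structure Numerals (v : ℕ → Set (S × S)) (c : ℕ → S) : Prop where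
  zero (k : ℕ) : (c k, c 0) ∈ v 1
  succ (k : ℕ) : (c k, c (k + 1)) ∈ v 2
  fst : (c 0, c 0) ∈ v 3
  snd : (c 0, c 0) ∈ v 4
  pair {x y : S} : (x, c 0) ∈ v 1 → (y, c 0) ∈ v 1 →
    ∃ p, (p, c 0) ∈ v 1 ∧ (p, x) ∈ v 3 ∧ (p, y) ∈ v 4

/-- The elements coding a list. -/
def Codes (v : ℕ → Set (S × S)) (c : ℕ → S) : List ℕ → Set S
  | [] => {c 0}
  | k :: w => {a | (a, c 0) ∈ v 1 ∧ (a, c k) ∈ v 3 ∧ ∃ b ∈ Codes v c w, (a, b) ∈ v 4}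

namespace Numerals

variable {c : ℕ → S} {a : S} {w : List ℕ}

theorem zero_of_codes (hc : Numerals v c) (ha : a ∈ Codes v c w) : (a, c 0) ∈ v 1 := by
  cases w with
  | nil => cases ha; exact hc.zero 0
  | cons k w => exact ha.1

theorem fst_of_codes (hc : Numerals v c) (ha : a ∈ Codes v c w) : (a, c w.headI) ∈ v 3 := by
  cases w with
  | nil => cases ha; exact hc.fst
  | cons k w => exact ha.2.1

theorem snd_of_codes (hc : Numerals v c) (ha : a ∈ Codes v c w) :
    ∃ b ∈ Codes v c w.tail, (a, b) ∈ v 4 := by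
  cases w with
  | nil => cases ha; exact ⟨c 0, rfl, hc.snd⟩
  | cons k w => exact ha.2.2

theorem exists_cons (hc : Numerals v c) (ha : a ∈ Codes v c w) (k : ℕ) :
    ∃ p ∈ Codes v c (k :: w), (p, c k) ∈ v 3 ∧ (p, a) ∈ v 4 := by
  obtain ⟨p, h₁, h₂, h₃⟩ := hc.pair (hc.zero k) (hc.zero_of_codes ha)
  exact ⟨p, ⟨h₁, h₂, a, ha, h₃⟩, h₂, h₃⟩

theorem fstZero_of_codes (hc : Numerals v c) (ha : a ∈ Codes v c w) (hw : w.headI = 0) {b : S}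
    (hb : (b, c 0) ∈ v 1) : (a, b) ∈ fstZero.eval v :=
  ⟨c 0, ⟨c 0, hw ▸ hc.fst_of_codes ha, rfl, hc.zero 0⟩, hb⟩

theorem fstPos_of_codes (hc : Numerals v c) (ha : a ∈ Codes v c w) (hw : w.headI ≠ 0) {b : S}
    (hb : (b, c 0) ∈ v 1) : (a, b) ∈ fstPos.eval v := by
  obtain ⟨k, hk⟩ := Nat.exists_eq_succ_of_ne_zero hw
  have h := hc.fst_of_codes ha
  rw [hk] at h
  exact ⟨c 0, ⟨c k, ⟨c (k + 1), h, hc.succ k⟩, hc.zero k⟩, hb⟩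

theorem numeral_mem (hc : Numerals v c) (n : ℕ) : (c 0, c n) ∈ (numeral n).eval v := by
  induction n with
  | zero => exact hc.zero 0
  | succ n ih => exact ⟨c n, ih, hc.succ n⟩

theorem prog_mem (hc : Numerals v c) (d : Code) (hd : (codeAxioms d).Sat v) :
    ∀ {w x : List ℕ}, x ∈ d.eval w → ∀ {a}, a ∈ Codes v c w →
      ∃ b ∈ Codes v c x, (a, b) ∈ (prog d).eval v := by
  induction d with
  | zero' =>
    simp only [codeAxioms, stepAxioms, sat_cons, eval_incl] at hd
    intro w x hx a ha
    simp only [Code.zero'_eval, Part.pure_eq_some, Part.mem_some_iff] at hx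
    subst hx
    obtain ⟨p, hp, h₁, h₂⟩ := hc.exists_cons ha 0
    exact ⟨p, hp, hd.1 _ _ ⟨⟨c 0, hc.zero_of_codes ha, h₁⟩, h₂⟩⟩
  | succ =>
    simp only [codeAxioms, stepAxioms, sat_cons, eval_incl] at hd
    intro w x hx a ha
    simp only [Code.succ_eval, Part.pure_eq_some, Part.mem_some_iff] at hx
    subst hx
    obtain ⟨p, hp, h₁, h₂⟩ := hc.exists_cons (w := []) (a := c 0) rfl (w.headI + 1)
    exact ⟨p, hp, hd.1 _ _ ⟨⟨_, ⟨_, hc.fst_of_codes ha, hc.succ _⟩, h₁⟩,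
      ⟨c 0, hc.zero_of_codes ha, h₂⟩⟩⟩
  | tail =>
    simp only [codeAxioms, stepAxioms, sat_cons, eval_incl] at hd
    intro w x hx a ha
    simp only [Code.tail_eval, Part.pure_eq_some, Part.mem_some_iff] at hx
    subst hx
    obtain ⟨b, hb, h⟩ := hc.snd_of_codes ha
    exact ⟨b, hb, hd.1 _ _ h⟩
  | cons f g hf hg =>
    simp only [codeAxioms, stepAxioms, sat_append, sat_cons, eval_incl] at hd
    obtain ⟨⟨hd, -⟩, hdf, hdg⟩ := hd
    intro w x hx a ha
    simp only [Code.cons_eval, Part.pure_eq_some, Part.bind_eq_bind, Part.mem_bind_iff,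
      Part.mem_some_iff] at hx
    obtain ⟨y, hy, z, hz, rfl⟩ := hx
    obtain ⟨b, hb, hab⟩ := hf hdf hy ha
    obtain ⟨b', hb', hab'⟩ := hg hdg hz ha
    obtain ⟨p, hp, h₁, h₂⟩ := hc.exists_cons hb' y.headI
    exact ⟨p, hp, hd _ _ ⟨⟨_, ⟨_, hab, hc.fst_of_codes hb⟩, h₁⟩, ⟨_, hab', h₂⟩⟩⟩
  | comp f g hf hg =>
    simp only [codeAxioms, stepAxioms, sat_append, sat_cons, eval_incl] at hd
    obtain ⟨⟨hd, -⟩, hdf, hdg⟩ := hd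
    intro w x hx a ha
    rw [Code.comp_eval] at hx
    obtain ⟨y, hy, hx⟩ := Part.mem_bind_iff.1 hx
    obtain ⟨b, hb, hab⟩ := hg hdg hy ha
    obtain ⟨b', hb', hbb'⟩ := hf hdf hx hb
    exact ⟨b', hb', hd _ _ ⟨_, hab, hbb'⟩⟩
  | case f g hf hg =>
    simp only [codeAxioms, stepAxioms, sat_append, sat_cons, eval_incl] at hd
    obtain ⟨⟨hd₀, hd₁, -⟩, hdf, hdg⟩ := hd
    intro w x hx a ha
    simp only [Code.case_eval] at hx
    obtain ⟨t, ht, hat⟩ := hc.snd_of_codes ha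
    rcases hw : w.headI with _ | k
    · rw [hw] at hx
      obtain ⟨b, hb, htb⟩ := hf hdf hx ht
      exact ⟨b, hb, hd₀ _ _ ⟨hc.fstZero_of_codes ha hw (hc.zero_of_codes hb), ⟨t, hat, htb⟩⟩⟩
    · rw [hw] at hx
      obtain ⟨p, hp, h₁, h₂⟩ := hc.exists_cons ht k
      obtain ⟨b, hb, hpb⟩ := hg hdg hx hp
      have h := hc.fst_of_codes ha
      rw [hw] at h
      exact ⟨b, hb, hd₁ _ _ ⟨p, ⟨⟨_, ⟨_, h, hc.succ k⟩, h₁⟩, ⟨_, hat, h₂⟩⟩, hpb⟩⟩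
  | fix f hf =>
    simp only [codeAxioms, stepAxioms, sat_append, sat_cons, eval_incl] at hd
    obtain ⟨⟨hd₀, hd₁, -⟩, hdf⟩ := hd
    intro w x hx
    simp only [Code.fix_eval] at hx
    refine PFun.fixInduction' (C := fun w => ∀ {a}, a ∈ Codes v c w →
      ∃ b ∈ Codes v c x, (a, b) ∈ (prog (.fix f)).eval v) hx ?_ ?_
    · intro w hw a ha
      obtain ⟨y, hy, h⟩ := (Part.mem_map_iff _).1 hw
      obtain ⟨b, hb, hab⟩ := hf hdf hy ha
      obtain ⟨t, ht, hbt⟩ := hc.snd_of_codes hb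
      split_ifs at h with h0
      cases h
      exact ⟨t, ht, hd₀ _ _ ⟨b, hab, hc.fstZero_of_codes hb h0 (hc.zero_of_codes ht), hbt⟩⟩
    · intro w w' _ hw ih a ha
      obtain ⟨y, hy, h⟩ := (Part.mem_map_iff _).1 hw
      obtain ⟨b, hb, hab⟩ := hf hdf hy ha
      obtain ⟨t, ht, hbt⟩ := hc.snd_of_codes hb
      split_ifs at h with h0
      cases h
      obtain ⟨d, hd, htd⟩ := ih ht
      exact ⟨d, hd, hd₁ _ _
        ⟨t, ⟨b, hab, hc.fstPos_of_codes hb h0 (hc.zero_of_codes ht), hbt⟩, htd⟩⟩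

end Numerals

theorem exists_numerals (hv : baseAxioms.Sat v) (x : S) :
    ∃ c : ℕ → S, Numerals v c ∧ (x, c 0) ∈ v 1 := by
  simp only [baseAxioms, sat_cons, eval_incl] at hv
  obtain ⟨h₁, h₂, h₃, h₄, h₅, h₆, -⟩ := hv
  obtain ⟨z', ⟨z, hxz, hz, hzz⟩, -⟩ := h₁ x x rfl
  obtain rfl : z = z' := hz
  have hstep : ∀ a : {a // (a, z) ∈ v 1}, ∃ b : {b // (b, z) ∈ v 1}, (a.1, b.1) ∈ v 2 := by
    rintro ⟨a, ha⟩
    obtain ⟨b, hab, hb⟩ := h₂ _ _ ha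
    exact ⟨⟨b, hb⟩, hab⟩
  choose next hnext using hstep
  refine ⟨fun k => (next^[k] ⟨z, hzz⟩).1, ⟨?_, ?_, ?_, ?_, ?_⟩, hxz⟩
  · exact fun k => (next^[k] ⟨z, hzz⟩).2
  · intro k
    simp only [Function.iterate_succ_apply']
    exact hnext _
  · exact h₅ _ _ ⟨rfl, hzz⟩
  · exact h₆ _ _ ⟨rfl, hzz⟩
  · intro a b ha hb
    obtain ⟨p, hpa, hpb⟩ := h₃ a b ⟨z, ha, hb⟩
    exact ⟨p, h₄ _ _ ⟨a, hpa, ha⟩, hpa, hpb⟩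

/-- If `c` returns zero on `n`, then the theory has trivial models only. -/
theorem not_nontriv_of_eval_zero {c : Code} {n : ℕ} (h : [0] ∈ c.eval [n])
    (hv : (theory c n).Sat v) : ¬ (theory c n).Nontriv v := by
  simp only [theory, codeTheory, sat_cons, sat_append, refutation, eval_incl] at hv
  obtain ⟨href, hbase, hcode, hcol⟩ := hv
  have hdiag : ∀ x, (x, x) ∈ v 0 := by
    intro x
    obtain ⟨d, hd, hx⟩ := exists_numerals hbase x
    obtain ⟨a, ha, hfst, hsnd⟩ := hd.exists_cons (w := []) (a := d 0) rfl n
    obtain ⟨b, hb, hab⟩ := hd.prog_mem c hcode h ha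
    have h0 : (d 0, d 0) ∈ v 0 := href _ _
      ⟨⟨b, ⟨a, ⟨⟨d n, hd.numeral_mem n, hfst⟩, ⟨d 0, hd.zero 0, hsnd⟩⟩, hab⟩,
        hd.fst_of_codes hb⟩, hd.zero 0⟩
    simp only [baseAxioms, sat_cons, eval_incl] at hbase
    obtain ⟨-, -, -, -, -, -, h₇, h₈, -⟩ := hbase
    have hx0 : (x, d 0) ∈ v 0 := h₈ _ _ ⟨d 0, hx, h0⟩
    have hxe : x = d 0 := h₇ _ _ hx0
    rwa [← hxe] at hx0
  have hsub : ∀ x y, (x, y) ∈ v 0 → x = y := by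
    simp only [baseAxioms, sat_cons, eval_incl] at hbase
    exact hbase.2.2.2.2.2.2.1
  rintro ⟨i, hi, hne⟩
  apply hne
  have hmem := lt_of_mem_vars_theory c n i hi
  have heq : (bot ⨾ var i).eval v = bot.eval v :=
    hcol _ (List.mem_map.2 ⟨i, List.mem_range.2 hmem, rfl⟩)
  ext ⟨x, y⟩
  constructor
  · intro hxy
    have : (x, y) ∈ (bot ⨾ var i).eval v := ⟨x, hdiag x, hxy⟩
    rw [heq] at this
    exact hsub x y this
  · rintro (rfl : x = y)
    have : (x, x) ∈ (bot ⨾ var i).eval v := heq ▸ hdiag x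
    obtain ⟨z, hxz, hz⟩ := this
    cases hsub _ _ hxz
    exact hz

/-! ### Finite models from halting computations -/

/-- The code of a list as a number. -/
def listCode : List ℕ → ℕ
  | [] => 0
  | k :: w => Nat.pair k (listCode w)

theorem unpair_listCode (w : List ℕ) :
    Nat.unpair (listCode w) = (w.headI, listCode w.tail) := by
  cases w <;> simp [listCode]
  rfl

theorem headI_le_listCode (w : List ℕ) : w.headI ≤ listCode w := by
  have := Nat.unpair_left_le (listCode w)
  rwa [unpair_listCode] at this

theorem tail_le_listCode (w : List ℕ) : listCode w.tail ≤ listCode w := by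
  have := Nat.unpair_right_le (listCode w)
  rwa [unpair_listCode] at this

/-- Evaluation of codes all of whose intermediate values are bounded by `K`. -/
inductive Run (K : ℕ) : Code → List ℕ → List ℕ → Prop
  | zero' {w} : listCode w ≤ K → listCode (0 :: w) ≤ K → Run K .zero' w (0 :: w)
  | succ {w} : listCode w ≤ K → listCode [w.headI + 1] ≤ K → Run K .succ w [w.headI + 1]
  | tail {w} : listCode w ≤ K → Run K .tail w w.tail
  | cons {f g w x y} : Run K f w x → Run K g w y → listCode (x.headI :: y) ≤ K →
      Run K (.cons f g) w (x.headI :: y)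
  | comp {f g w x y} : Run K g w x → Run K f x y → Run K (.comp f g) w y
  | case_zero {f g w x} : listCode w ≤ K → w.headI = 0 → Run K f w.tail x →
      Run K (.case f g) w x
  | case_succ {f g w x k} : listCode w ≤ K → w.headI = k + 1 → Run K g (k :: w.tail) x →
      Run K (.case f g) w x
  | fix_halt {f w x} : Run K f w x → x.headI = 0 → Run K (.fix f) w x.tail
  | fix_next {f w x y} : Run K f w x → x.headI ≠ 0 → Run K (.fix f) x.tail y →
      Run K (.fix f) w y

theorem Run.bounds {K : ℕ} {c : Code} {w x : List ℕ} (h : Run K c w x) :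
    listCode w ≤ K ∧ listCode x ≤ K := by
  induction h with
  | zero' h₁ h₂ | succ h₁ h₂ => exact ⟨h₁, h₂⟩
  | tail h => exact ⟨h, (tail_le_listCode _).trans h⟩
  | cons _ _ h ih _ => exact ⟨ih.1, h⟩
  | comp _ _ ih₁ ih₂ => exact ⟨ih₁.1, ih₂.2⟩
  | case_zero h _ _ ih | case_succ h _ _ ih => exact ⟨h, ih.2⟩
  | fix_halt _ _ ih => exact ⟨ih.1, (tail_le_listCode _).trans ih.2⟩
  | fix_next _ _ _ ih₁ ih₂ => exact ⟨ih₁.1, ih₂.2⟩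

theorem eventually_run (c : Code) :
    ∀ {w x : List ℕ}, x ∈ c.eval w → ∀ᶠ K in atTop, Run K c w x := by
  induction c with
  | zero' =>
    intro w x hx
    simp only [Code.zero'_eval, Part.pure_eq_some, Part.mem_some_iff] at hx
    subst hx
    filter_upwards [eventually_ge_atTop (listCode w), eventually_ge_atTop (listCode (0 :: w))]
      with K h₁ h₂ using .zero' h₁ h₂
  | succ =>
    intro w x hx
    simp only [Code.succ_eval, Part.pure_eq_some, Part.mem_some_iff] at hx
    subst hx
    filter_upwards [eventually_ge_atTop (listCode w), eventually_ge_atTop (listCode [w.headI + 1])]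
      with K h₁ h₂ using .succ h₁ h₂
  | tail =>
    intro w x hx
    simp only [Code.tail_eval, Part.pure_eq_some, Part.mem_some_iff] at hx
    subst hx
    filter_upwards [eventually_ge_atTop (listCode w)] with K h using .tail h
  | cons f g hf hg =>
    intro w x hx
    simp only [Code.cons_eval, Part.pure_eq_some, Part.bind_eq_bind, Part.mem_bind_iff,
      Part.mem_some_iff] at hx
    obtain ⟨y, hy, z, hz, rfl⟩ := hx
    filter_upwards [hf hy, hg hz, eventually_ge_atTop (listCode (y.headI :: z))]
      with K h₁ h₂ h₃ using .cons h₁ h₂ h₃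
  | comp f g hf hg =>
    intro w x hx
    rw [Code.comp_eval] at hx
    obtain ⟨y, hy, hx⟩ := Part.mem_bind_iff.1 hx
    filter_upwards [hg hy, hf hx] with K h₁ h₂ using .comp h₁ h₂
  | case f g hf hg =>
    intro w x hx
    simp only [Code.case_eval] at hx
    rcases hw : w.headI with _ | k
    · rw [hw] at hx
      filter_upwards [eventually_ge_atTop (listCode w), hf hx] with K h₁ h₂ using
        .case_zero h₁ hw h₂
    · rw [hw] at hx
      filter_upwards [eventually_ge_atTop (listCode w), hg hx] with K h₁ h₂ using
        .case_succ h₁ hw h₂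
  | fix f hf =>
    intro w x hx
    simp only [Code.fix_eval] at hx
    refine PFun.fixInduction' (C := fun w => ∀ᶠ K in atTop, Run K (.fix f) w x) hx ?_ ?_
    · intro w hw
      obtain ⟨y, hy, h⟩ := (Part.mem_map_iff _).1 hw
      split_ifs at h with h0
      cases h
      filter_upwards [hf hy] with K h using .fix_halt h h0
    · intro w w' _ hw ih
      obtain ⟨y, hy, h⟩ := (Part.mem_map_iff _).1 hw
      split_ifs at h with h0
      cases h
      filter_upwards [hf hy, ih] with K h₁ h₂ using .fix_next h₁ h0 h₂

/-- The universe of the finite model: pairs of numbers at most `K + 1`, where `K + 1` stands for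
everything exceeding `K`. -/
abbrev Trunc (K : ℕ) : Type := Fin (K + 2) × Fin (K + 2)

/-- The number denoted by an element of the finite model. -/
def toNat {K : ℕ} (p : Trunc K) : ℕ := min (Nat.pair p.1 p.2) (K + 1)

/-- The element of the finite model that denotes a given number. -/
def elem (K x : ℕ) : Trunc K :=
  if h : x ≤ K then
    (⟨x.unpair.1, by have := x.unpair_left_le; omega⟩,
      ⟨x.unpair.2, by have := x.unpair_right_le; omega⟩)
  else (Fin.last _, Fin.last _)

section Trunc

variable {K : ℕ}

theorem toNat_elem (x : ℕ) : toNat (elem K x) = min x (K + 1) := by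
  unfold toNat elem
  split_ifs with h
  · simp
  · have := Nat.left_le_pair (K + 1) (K + 1)
    simp only [Fin.val_last]
    omega

theorem elem_toNat {p : Trunc K} (h : toNat p ≤ K) : elem K (toNat p) = p := by
  have h' : toNat p = Nat.pair p.1 p.2 := by unfold toNat at h ⊢; omega
  rw [elem, dif_pos h]
  ext <;> simp [h']

theorem elem_fst {x : ℕ} (h : x ≤ K) : ((elem K x).1 : ℕ) = x.unpair.1 := by
  rw [elem, dif_pos h]

theorem elem_snd {x : ℕ} (h : x ≤ K) : ((elem K x).2 : ℕ) = x.unpair.2 := by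
  rw [elem, dif_pos h]

theorem toNat_lt (p : Trunc K) : toNat p < K + 2 := by unfold toNat; omega

/-- The interpretation of a code: the value is determined on those inputs that have a bounded
run. -/
def progRel (K : ℕ) (c : Code) : Set (Trunc K × Trunc K) :=
  {p | ∀ w x, Run K c w x → p.1 = elem K (listCode w) → p.2 = elem K (listCode x)}

/-- The assignment of the finite model. -/
def truncModel (K : ℕ) : ℕ → Set (Trunc K × Trunc K)
  | 0 => ∅
  | 1 => {p | p.2 = elem K 0}
  | 2 => {p | p.2 = elem K (toNat p.1 + 1)}
  | 3 => {p | (p.1.1 : ℕ) = toNat p.2}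
  | 4 => {p | (p.1.2 : ℕ) = toNat p.2}
  | i + 5 => {p | ∀ c, index c = i → p ∈ progRel K c}

theorem mem_zero {p q : Trunc K} : (p, q) ∈ truncModel K 1 ↔ q = elem K 0 := Iff.rfl

theorem mem_succ {p q : Trunc K} :
    (p, q) ∈ truncModel K 2 ↔ q = elem K (toNat p + 1) := Iff.rfl

theorem mem_fst {p q : Trunc K} : (p, q) ∈ truncModel K 3 ↔ (p.1 : ℕ) = toNat q := Iff.rfl

theorem mem_snd {p q : Trunc K} : (p, q) ∈ truncModel K 4 ↔ (p.2 : ℕ) = toNat q := Iff.rfl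

theorem mem_prog {c : Code} {p q : Trunc K} : (p, q) ∈ truncModel K (index c + 5) ↔
    ∀ w x, Run K c w x → p = elem K (listCode w) → q = elem K (listCode x) :=
  ⟨fun h => h c rfl, fun h d hd => by rw [index_injective hd]; exact h⟩

theorem Run.eq_of_mem {c : Code} {w x : List ℕ} (h : Run K c w x) {q : Trunc K}
    (hq : (elem K (listCode w), q) ∈ truncModel K (index c + 5)) : q = elem K (listCode x) :=
  mem_prog.1 hq w x h rfl

theorem eq_of_mem_fst {w : List ℕ} (hw : listCode w ≤ K) {q : Trunc K}
    (h : (elem K (listCode w), q) ∈ truncModel K 3) : q = elem K w.headI := by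
  rw [mem_fst, elem_fst hw, unpair_listCode] at h
  have := headI_le_listCode w
  dsimp only at h
  rw [h, elem_toNat (by omega)]

theorem eq_of_mem_snd {w : List ℕ} (hw : listCode w ≤ K) {q : Trunc K}
    (h : (elem K (listCode w), q) ∈ truncModel K 4) : q = elem K (listCode w.tail) := by
  rw [mem_snd, elem_snd hw, unpair_listCode] at h
  have := tail_le_listCode w
  dsimp only at h
  rw [h, elem_toNat (by omega)]

theorem eq_cons {k : ℕ} {w : List ℕ} (hw : listCode (k :: w) ≤ K) {p : Trunc K}
    (h₁ : (p, elem K k) ∈ truncModel K 3) (h₂ : (p, elem K (listCode w)) ∈ truncModel K 4) :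
    p = elem K (listCode (k :: w)) := by
  have hk := headI_le_listCode (k :: w)
  have ht := tail_le_listCode (k :: w)
  simp only [List.headI_cons, List.tail_cons] at hk ht
  rw [mem_fst, toNat_elem, min_eq_left (by omega)] at h₁
  rw [mem_snd, toNat_elem, min_eq_left (by omega)] at h₂
  ext
  · rw [h₁, elem_fst hw, unpair_listCode]; rfl
  · rw [h₂, elem_snd hw, unpair_listCode]; rfl

theorem elem_inj {x y : ℕ} (hx : x ≤ K) (h : elem K x = elem K y) : x = y := by
  have := congrArg toNat h
  rw [toNat_elem, toNat_elem] at this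
  omega

theorem headI_eq_zero_of_fstZero {w : List ℕ} (hw : listCode w ≤ K) {q : Trunc K}
    (h : (elem K (listCode w), q) ∈ fstZero.eval (truncModel K)) : w.headI = 0 := by
  obtain ⟨_, ⟨b, hb, hb', h0⟩, -⟩ := h
  cases hb'
  cases eq_of_mem_fst hw hb
  exact elem_inj ((headI_le_listCode w).trans hw) (mem_zero.1 h0)

theorem headI_ne_zero_of_fstPos {w : List ℕ} (hw : listCode w ≤ K) {q : Trunc K}
    (h : (elem K (listCode w), q) ∈ fstPos.eval (truncModel K)) : w.headI ≠ 0 := by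
  obtain ⟨_, ⟨b, ⟨b', hb, hs⟩, -⟩, -⟩ := h
  cases eq_of_mem_fst hw hb
  have := elem_inj ((headI_le_listCode w).trans hw) (mem_succ.1 hs)
  omega

theorem sat_stepAxioms (c : Code) : (stepAxioms c).Sat (truncModel K) := by
  cases c with
  | zero' =>
    simp only [stepAxioms, sat_cons, eval_incl, sat_nil, and_true]
    rintro _ q ⟨⟨z, hz, hq⟩, hq'⟩
    refine mem_prog.2 fun w x hr hp => ?_
    cases mem_zero.1 hz
    cases hp
    cases hr with
    | zero' _ hb => exact eq_cons hb hq hq'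
  | succ =>
    simp only [stepAxioms, sat_cons, eval_incl, sat_nil, and_true]
    rintro _ q ⟨⟨s, ⟨k, hk, hs⟩, hq⟩, ⟨z, hz, hq'⟩⟩
    refine mem_prog.2 fun w x hr hp => ?_
    cases mem_zero.1 hz
    cases hp
    cases hr with
    | succ hw hb =>
      cases eq_of_mem_fst hw hk
      have := headI_le_listCode w
      have hs := mem_succ.1 hs
      rw [toNat_elem, min_eq_left (by omega)] at hs
      cases hs
      exact eq_cons (w := []) hb hq hq'
  | tail =>
    simp only [stepAxioms, sat_cons, eval_incl, sat_nil, and_true]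
    intro p q hq
    refine mem_prog.2 fun w x hr hp => ?_
    cases hp
    cases hr with
    | tail hw => exact eq_of_mem_snd hw hq
  | cons f g =>
    simp only [stepAxioms, sat_cons, eval_incl, sat_nil, and_true]
    rintro _ q ⟨⟨k, ⟨a, ha, hk⟩, hq⟩, ⟨b, hb, hq'⟩⟩
    refine mem_prog.2 fun w x hr hp => ?_
    cases hp
    cases hr with
    | cons hf hg hx =>
      cases hf.eq_of_mem ha
      cases hg.eq_of_mem hb
      cases eq_of_mem_fst hf.bounds.2 hk
      exact eq_cons hx hq hq'
  | comp f g =>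
    simp only [stepAxioms, sat_cons, eval_incl, sat_nil, and_true]
    rintro _ q ⟨a, ha, hq⟩
    refine mem_prog.2 fun w x hr hp => ?_
    cases hp
    cases hr with
    | comp hg hf =>
      cases hg.eq_of_mem ha
      exact hf.eq_of_mem hq
  | case f g =>
    simp only [stepAxioms, sat_cons, eval_incl, sat_nil, and_true]
    constructor
    · rintro _ q ⟨h0, a, ha, hq⟩
      refine mem_prog.2 fun w x hr hp => ?_
      cases hp
      cases hr with
      | case_zero hw _ hf =>
        cases eq_of_mem_snd hw ha
        exact hf.eq_of_mem hq
      | case_succ hw hk _ =>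
        have := headI_eq_zero_of_fstZero hw h0
        omega
    · rintro _ q ⟨a, ⟨⟨k, ⟨k', hk', hs⟩, hk⟩, ⟨t, ht, hat⟩⟩, hq⟩
      refine mem_prog.2 fun w x hr hp => ?_
      cases hp
      have hw := hr.bounds.1
      have hle := headI_le_listCode w
      cases eq_of_mem_fst hw hk'
      have hs := elem_inj (hle.trans hw) (mem_succ.1 hs)
      dsimp only at hs
      cases hr with
      | case_zero _ h0 _ => omega
      | @case_succ _ _ _ _ m _ hm hg =>
        have hkm : toNat k = m := by omega
        have hkm' : k = elem K m := by rw [← hkm, elem_toNat (by omega)]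
        cases hkm'
        cases eq_of_mem_snd hw ht
        cases eq_cons hg.bounds.1 hk hat
        exact hg.eq_of_mem hq
  | fix f =>
    simp only [stepAxioms, sat_cons, eval_incl, sat_nil, and_true]
    constructor
    · rintro _ q ⟨a, ha, h0, hq⟩
      refine mem_prog.2 fun w x hr hp => ?_
      cases hp
      cases hr with
      | fix_halt hf _ =>
        cases hf.eq_of_mem ha
        exact eq_of_mem_snd hf.bounds.2 hq
      | fix_next hf hne _ =>
        cases hf.eq_of_mem ha
        exact absurd (headI_eq_zero_of_fstZero hf.bounds.2 h0) hne
    · rintro _ q ⟨b, ⟨a, ha, h0, hb⟩, hq⟩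
      refine mem_prog.2 fun w x hr hp => ?_
      cases hp
      cases hr with
      | fix_halt hf hz =>
        cases hf.eq_of_mem ha
        exact absurd hz (headI_ne_zero_of_fstPos hf.bounds.2 h0)
      | fix_next hf _ hx =>
        cases hf.eq_of_mem ha
        cases eq_of_mem_snd hf.bounds.2 hb
        exact hx.eq_of_mem hq

theorem sat_codeAxioms (c : Code) : (codeAxioms c).Sat (truncModel K) := by
  induction c with
  | zero' | succ | tail => exact sat_stepAxioms _
  | cons f g hf hg | comp f g hf hg | case f g hf hg =>
    exact sat_append.2 ⟨sat_stepAxioms _, sat_append.2 ⟨hf, hg⟩⟩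
  | fix f hf => exact sat_append.2 ⟨sat_stepAxioms _, hf⟩

theorem sat_baseAxioms : baseAxioms.Sat (truncModel K) := by
  simp only [baseAxioms, sat_cons, eval_incl, sat_nil, and_true]
  refine ⟨?_, ?_, ?_, ?_, ?_, ?_, ?_, ?_⟩
  · exact fun x y _ => ⟨elem K 0, ⟨elem K 0, rfl, rfl, rfl⟩, rfl⟩
  · exact fun x y hy => ⟨elem K (toNat x + 1), rfl, hy⟩
  · exact fun x y _ => ⟨(⟨toNat x, toNat_lt x⟩, ⟨toNat y, toNat_lt y⟩), rfl, rfl⟩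
  · rintro x y ⟨z, -, hz⟩
    exact hz
  · rintro x y ⟨hxy, hx⟩
    obtain rfl : x = y := hxy
    cases mem_zero.1 hx
    simp [mem_eval_var, mem_fst, elem_fst, toNat_elem]
  · rintro x y ⟨hxy, hx⟩
    obtain rfl : x = y := hxy
    cases mem_zero.1 hx
    simp [mem_eval_var, mem_snd, elem_snd, toNat_elem]
  · exact fun x y h => h.elim
  · rintro x y ⟨z, -, hz⟩
    exact hz

theorem sat_collapseAxioms (M : ℕ) : (collapseAxioms M).Sat (truncModel K) := by
  intro p hp
  obtain ⟨i, -, rfl⟩ := List.mem_map.1 hp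
  ext q
  exact ⟨fun ⟨_, h, _⟩ => h, fun h => h.elim⟩

theorem eq_of_mem_numeral {n : ℕ} (hn : n ≤ K) {p q : Trunc K}
    (h : (p, q) ∈ (numeral n).eval (truncModel K)) : q = elem K n := by
  induction n generalizing q with
  | zero => exact h
  | succ n ih =>
    obtain ⟨r, hr, hq⟩ := h
    cases ih (by omega) hr
    rw [mem_eval_var, mem_succ, toNat_elem, min_eq_left (by omega)] at hq
    exact hq

theorem holds_refutation {c : Code} {n : ℕ} (h : Run K c [n] [1]) :
    (refutation c n).1.eval (truncModel K) = (refutation c n).2.eval (truncModel K) := by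
  refine eval_incl.2 ?_
  rintro p q ⟨⟨b, ⟨a, ⟨⟨k, hk, ha⟩, ⟨z, hz, ha'⟩⟩, hb⟩, hq⟩, hq'⟩
  have hn := h.bounds.1
  cases eq_of_mem_numeral ((headI_le_listCode [n]).trans hn) hk
  cases mem_zero.1 hz
  cases eq_cons (w := []) hn ha ha'
  cases h.eq_of_mem hb
  have hone := eq_of_mem_fst h.bounds.2 hq
  have := elem_inj (Nat.zero_le K) ((mem_zero.1 hq').symm.trans hone)
  simp at this

end Trunc

/-- If `c` returns one on `n`, then the theory has a finite nontrivial model. -/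
theorem exists_finite_model_of_eval_one {c : Code} {n : ℕ} (h : [1] ∈ c.eval [n]) :
    ∃ (S : Type) (_ : Finite S) (v : ℕ → Set (S × S)),
      (theory c n).Sat v ∧ (theory c n).Nontriv v := by
  obtain ⟨K, hK⟩ := (eventually_run c h).exists
  refine ⟨Trunc K, inferInstance, truncModel K, ?_, 0, ?_, ?_⟩
  · exact sat_cons.2 ⟨holds_refutation hK, sat_append.2 ⟨sat_baseAxioms,
      sat_append.2 ⟨sat_codeAxioms c, sat_collapseAxioms _⟩⟩⟩
  · simp [theory, vars_cons, refutation, incl, vars]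
  · intro h0
    have : (elem K 0, elem K 0) ∈ truncModel K 0 := h0 ▸ rfl
    exact this.elim

/-! ### Computability of the reduction -/

theorem primrec_code_numeral : Primrec fun n => (numeral n).code := by
  have h : Primrec fun n : ℕ => Nat.rec (motive := fun _ => ℕ) zero.code
      (fun _ x => 5 * Nat.pair x succ.code + 3) n := by
    refine Primrec.nat_rec₁ _ ?_
    exact Primrec.nat_add.comp (Primrec.nat_mul.comp (Primrec.const 5)
      (Primrec₂.natPair.comp Primrec.snd (Primrec.const _))) (Primrec.const 3)
  refine h.of_eq fun n => ?_
  induction n with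
  | zero => rfl
  | succ n ih => simp only [numeral, code, ← ih]

theorem primrec_code_inter {s t : ℕ → RelTerm} (hs : Primrec fun n => (s n).code)
    (ht : Primrec fun n => (t n).code) : Primrec fun n => (s n ⊓ᵣ t n).code :=
  Primrec.nat_add.comp (Primrec.nat_mul.comp (Primrec.const 5)
    (Primrec₂.natPair.comp hs ht)) (Primrec.const 2)

theorem primrec_code_comp {s t : ℕ → RelTerm} (hs : Primrec fun n => (s n).code)
    (ht : Primrec fun n => (t n).code) : Primrec fun n => (s n ⨾ t n).code :=
  Primrec.nat_add.comp (Primrec.nat_mul.comp (Primrec.const 5)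
    (Primrec₂.natPair.comp hs ht)) (Primrec.const 3)

theorem primrec_code_theory (c : Code) : Primrec fun n => (theory c n).code := by
  have hlhs : Primrec fun n => (refutation c n).2.code :=
    primrec_code_inter (primrec_code_comp (primrec_code_comp (primrec_code_inter
      (primrec_code_comp primrec_code_numeral (Primrec.const _)) (Primrec.const _))
      (Primrec.const _)) (Primrec.const _)) (Primrec.const _)
  have hpair : Primrec fun n => Nat.pair (refutation c n).1.code (refutation c n).2.code :=
    Primrec₂.natPair.comp (primrec_code_inter hlhs (Primrec.const _)) hlhs
  exact Primrec.encode.comp (Primrec.list_cons.comp hpair (Primrec.const _))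

end RelTerm

/-- There is a code for which the inputs with value zero and those with value one are computably
inseparable. -/
theorem exists_code_inseparable : ∃ c : Code, ∀ d : ℕ → Bool, Computable d →
    ¬ ((∀ n, [0] ∈ c.eval [n] → d n = false) ∧ (∀ n, [1] ∈ c.eval [n] → d n = true)) := by
  have hu : Partrec fun n : ℕ => (Denumerable.ofNat Nat.Partrec.Code n).eval n :=
    Nat.Partrec.Code.eval_part.comp (Computable.ofNat _) Computable.id
  obtain ⟨c, hc⟩ := Code.exists_code (Nat.Partrec'.part_iff₁.2 hu)
  have hmem : ∀ n x : ℕ, x ∈ (Denumerable.ofNat Nat.Partrec.Code n).eval n →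
      [x] ∈ c.eval [n] := by
    intro n x hx
    have h := hc (n ::ᵥ List.Vector.nil)
    change c.eval [n] = _ at h
    rw [h]
    exact (Part.mem_map_iff _).2 ⟨x, hx, rfl⟩
  refine ⟨c, fun d hd ⟨h₀, h₁⟩ => ?_⟩
  have hflip : Computable fun n => bif d n then 0 else 1 :=
    Computable.cond hd (Computable.const 0) (Computable.const 1)
  obtain ⟨e, he⟩ := Nat.Partrec.Code.exists_code.1 (Partrec.nat_iff.1 hflip.partrec)
  have hval : (bif d (Encodable.encode e) then 0 else 1) ∈
      (Denumerable.ofNat Nat.Partrec.Code (Encodable.encode e)).eval (Encodable.encode e) := by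
    rw [Denumerable.ofNat_encode, he]
    exact Part.mem_some _
  have hrun := hmem _ _ hval
  cases hdn : d (Encodable.encode e) with
  | false =>
    rw [hdn] at hrun
    simpa [hdn] using h₁ _ hrun
  | true =>
    rw [hdn] at hrun
    simpa [hdn] using h₀ _ hrun

/-- The consistency problem for representable pre-relation
algebras is unsolvable: no computable function decides (via the Gödel numbering
`RelConj.code`) whether a conjunction of equations admits an assignment of
binary relations on some set `S`, not all equal to the identity relation,
satisfying all equations.  The same holds with `S` required to be finite. -/
theorem representable_preRelationAlgebra_consistency_undecidable :
    (¬ ∃ f : ℕ → Bool, Computable f ∧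
      ∀ Φ : RelConj, (f Φ.code = true ↔
        ∃ (S : Type) (v : ℕ → Set (S × S)), Φ.Sat v ∧ Φ.Nontriv v)) ∧
    (¬ ∃ f : ℕ → Bool, Computable f ∧
      ∀ Φ : RelConj, (f Φ.code = true ↔
        ∃ (S : Type) (_ : Finite S) (v : ℕ → Set (S × S)),
          Φ.Sat v ∧ Φ.Nontriv v)) := by
  obtain ⟨c, hc⟩ := exists_code_inseparable
  constructor
  · rintro ⟨f, hf, h⟩
    refine hc (fun n => f (RelTerm.theory c n).code)
      (hf.comp (RelTerm.primrec_code_theory c).to_comp) ⟨fun n hn => ?_, fun n hn => ?_⟩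
    · rw [← Bool.not_eq_true, h]
      rintro ⟨S, v, hv, hne⟩
      exact RelTerm.not_nontriv_of_eval_zero hn hv hne
    · obtain ⟨S, -, v, hv⟩ := RelTerm.exists_finite_model_of_eval_one hn
      exact (h _).2 ⟨S, v, hv⟩
  · rintro ⟨f, hf, h⟩
    refine hc (fun n => f (RelTerm.theory c n).code)
      (hf.comp (RelTerm.primrec_code_theory c).to_comp) ⟨fun n hn => ?_, fun n hn => ?_⟩
    · rw [← Bool.not_eq_true, h]
      rintro ⟨S, -, v, hv, hne⟩
      exact RelTerm.not_nontriv_of_eval_zero hn hv hne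
    · exact (h _).2 (RelTerm.exists_finite_model_of_eval_one hn)
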